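/- Let N be a positive integer. Let Γ be a subgroup of GL₂(A_ℚ) of the form Γ = ∏_{p ≤ ∞} Γ_p, where Γ_∞ = SO₂(ℝ), for each finite prime p the group Γ_p is an open subgroup of GL₂(ℤ_p) whose image under the determinant map is all of ℤ_p^×, and Γ_p = GL₂(ℤ_p) for every prime p not dividing N. Then D_N contains representatives of every double coset of Z(A_ℚ)·GL₂(ℚ)\GL₂(A_ℚ)/Γ; that is, for every g ∈ GL₂(A_ℚ) there exist z ∈ Z(A_ℚ), γ ∈ GL₂(ℚ), d ∈ D_N and k ∈ Γ with g = z·γ·d·k. -/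

import Mathlib

noncomputable section

open Matrix

instance (p : Nat.Primes) : Fact (p : ℕ).Prime := ⟨p.2⟩

/-- The completion `ℚ_p` of `ℚ` at a prime `p`. -/
abbrev Qp (p : Nat.Primes) : Type := ℚ_[(p : ℕ)]

/-- Membership in `GL₂(ℤ_p)`: all entries are `p`-adic integers and the determinant is a
`p`-adic unit. -/
def InGL2Zp (p : Nat.Primes) (k : Matrix (Fin 2) (Fin 2) (Qp p)) : Prop :=
  (∀ i j, ‖k i j‖ ≤ 1) ∧ ‖k.det‖ = 1

/-- An element of `GL₂(𝔸_ℚ)`, recorded through its components: an invertible real `2 × 2`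
matrix at the infinite place, an invertible `2 × 2` matrix over `ℚ_p` at each finite prime
`p`, lying in `GL₂(ℤ_p)` for all but finitely many `p`. -/
structure AdelicGL2 where
  infty : Matrix (Fin 2) (Fin 2) ℝ
  fin : ∀ p : Nat.Primes, Matrix (Fin 2) (Fin 2) (Qp p)
  isUnit_infty : IsUnit infty.det
  isUnit_fin : ∀ p, IsUnit (fin p).det
  finite_not_integral : {p : Nat.Primes | ¬ InGL2Zp p (fin p)}.Finite

/-- Membership in the center `Z(𝔸_ℚ)` of `GL₂(𝔸_ℚ)`: every component is a scalar matrix. -/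
def AdelicGL2.IsCentral (z : AdelicGL2) : Prop :=
  (∃ y : ℝ, z.infty = y • (1 : Matrix (Fin 2) (Fin 2) ℝ)) ∧
    ∀ p : Nat.Primes, ∃ y : Qp p, z.fin p = y • (1 : Matrix (Fin 2) (Fin 2) (Qp p))

/-- Membership in `SO₂(ℝ)`. -/
def SO2 (k : Matrix (Fin 2) (Fin 2) ℝ) : Prop :=
  k * kᵀ = 1 ∧ k.det = 1

/-- Membership in the generating domain `𝒟_N`: the infinite component is `n(x) a(y)` with
`y ≥ √3/2`, the component at each prime `p ∤ N` is the identity, and the component at each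
prime lies in `GL₂(ℤ_p)`. -/
def InDN (N : ℕ) (d : AdelicGL2) : Prop :=
  (∃ x y : ℝ, Real.sqrt 3 / 2 ≤ y ∧ d.infty = !![1, x; 0, 1] * !![y, 0; 0, 1]) ∧
    (∀ p : Nat.Primes, ¬ (p : ℕ) ∣ N → d.fin p = 1) ∧
    ∀ p : Nat.Primes, InGL2Zp p (d.fin p)

theorem inGL2Zp_one (p : Nat.Primes) : InGL2Zp p 1 := by
  refine ⟨fun i j => ?_, by simp⟩
  rw [Matrix.one_apply]
  split_ifs <;> simp

theorem InGL2Zp.mul {p : Nat.Primes} {A B : Matrix (Fin 2) (Fin 2) (Qp p)}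
    (hA : InGL2Zp p A) (hB : InGL2Zp p B) : InGL2Zp p (A * B) := by
  refine ⟨fun i j => ?_, by rw [Matrix.det_mul, norm_mul, hA.2, hB.2, one_mul]⟩
  rw [Matrix.mul_apply, Fin.sum_univ_two]
  refine (Padic.nonarchimedean _ _).trans (max_le ?_ ?_) <;>
  · rw [norm_mul]
    exact mul_le_one₀ (hA.1 _ _) (norm_nonneg _) (hB.1 _ _)

theorem intCast_map_det {R : Type*} [CommRing R] (A : Matrix (Fin 2) (Fin 2) ℤ) :
    (A.map (Int.cast : ℤ → R)).det = (A.det : R) :=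
  ((Int.castRingHom R).map_det A).symm

/-- An integer matrix of determinant `±1` lies in `GL₂(ℤ_p)` for every `p`. -/
theorem inGL2Zp_intCast (p : Nat.Primes) {A : Matrix (Fin 2) (Fin 2) ℤ}
    (hA : A.det = 1 ∨ A.det = -1) : InGL2Zp p (A.map (Int.cast : ℤ → Qp p)) := by
  refine ⟨fun i j => Padic.norm_int_le_one _, ?_⟩
  rw [intCast_map_det]
  rcases hA with hA | hA <;> simp [hA]

theorem norm_prime_eq_one_of_ne {p q : Nat.Primes} (h : q ≠ p) :
    ‖((p : ℕ) : Qp q)‖ = 1 := by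
  rw [Padic.norm_natCast_eq_one_iff]
  exact (Nat.coprime_primes q.2 p.2).2 fun e => h (Subtype.ext e)

/-- Every element of `ℚ_p` is within any `p`-power distance of some `j * p ^ k` with `j` an
integer. -/
theorem exists_intCast_mul_zpow_near (p : Nat.Primes) (x : Qp p) {ε : ℝ} (hε : 0 < ε) :
    ∃ j k : ℤ, ‖x - (j : Qp p) * ((p : ℕ) : Qp p) ^ k‖ ≤ ε := by
  have hp0 : ((p : ℕ) : Qp p) ≠ 0 := Nat.cast_ne_zero.2 p.2.ne_zero
  by_cases hx : x = 0
  · exact ⟨0, 0, by simp [hx, hε.le]⟩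
  set k := x.valuation
  have hxn : ‖x * ((p : ℕ) : Qp p) ^ (-k)‖ ≤ 1 := by
    rw [norm_mul, Padic.norm_p_zpow, Padic.norm_eq_zpow_neg_valuation hx, neg_neg, ← zpow_add₀
      (Nat.cast_ne_zero.2 p.2.ne_zero)]
    simp [k]
  have hpos : 0 < ‖((p : ℕ) : Qp p) ^ k‖ := norm_pos_iff.2 (zpow_ne_zero _ hp0)
  obtain ⟨u, hu⟩ : ∃ u : ℤ_[(p : ℕ)], (u : Qp p) = x * ((p : ℕ) : Qp p) ^ (-k) :=
    ⟨⟨_, hxn⟩, rfl⟩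
  obtain ⟨j, hj⟩ := PadicInt.denseRange_intCast.exists_dist_lt u (div_pos hε hpos)
  refine ⟨j, k, ?_⟩
  have hj' : ‖(u : Qp p) - j‖ < ε / ‖((p : ℕ) : Qp p) ^ k‖ := by
    simpa [dist_eq_norm_sub, PadicInt.norm_def] using hj
  rw [hu] at hj'
  have h : x - (j : Qp p) * ((p : ℕ) : Qp p) ^ k =
      (x * ((p : ℕ) : Qp p) ^ (-k) - j) * ((p : ℕ) : Qp p) ^ k := by
    rw [sub_mul, mul_assoc, ← zpow_add₀ hp0]
    simp
  rw [h, norm_mul, ← le_div_iff₀ hpos]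
  exact hj'.le

theorem exists_rat_mul_inGL2Zp_of_norm_le (p : Nat.Primes) (g : Matrix (Fin 2) (Fin 2) (Qp p))
    (hg : g.det ≠ 0) (hle : ‖g 1 0‖ ≤ ‖g 1 1‖) :
    ∃ δ : Matrix (Fin 2) (Fin 2) ℚ, δ.det ≠ 0 ∧
      InGL2Zp p (δ.map (Rat.cast : ℚ → Qp p) * g) ∧
      ∀ q : Nat.Primes, q ≠ p → InGL2Zp q (δ.map (Rat.cast : ℚ → Qp q)) := by
  have hpQ : ((p : ℕ) : ℚ) ≠ 0 := Nat.cast_ne_zero.2 p.2.ne_zero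
  have hpR : ((p : ℕ) : ℝ) ≠ 0 := Nat.cast_ne_zero.2 p.2.ne_zero
  have hd : g 1 1 ≠ 0 := by
    intro h
    rw [h, norm_zero, norm_le_zero_iff] at hle
    exact hg (by rw [Matrix.det_fin_two, h, hle]; ring)
  set n := (g 1 1).valuation
  set m := g.det.valuation - n
  have hdn : 0 < ‖g 1 1‖ := norm_pos_iff.2 hd
  obtain ⟨j, k, hjk⟩ := exists_intCast_mul_zpow_near p
    (-(((p : ℕ) : Qp p) ^ (-m) * g 0 1 / g 1 1)) (inv_pos.2 hdn)
  set δ : Matrix (Fin 2) (Fin 2) ℚ :=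
    !![((p : ℕ) : ℚ) ^ (-m), (j : ℚ) * ((p : ℕ) : ℚ) ^ k; 0, ((p : ℕ) : ℚ) ^ (-n)] with hδ
  have hmap (q : Nat.Primes) : δ.map (Rat.cast : ℚ → Qp q) =
      !![((p : ℕ) : Qp q) ^ (-m), (j : Qp q) * ((p : ℕ) : Qp q) ^ k; 0,
        ((p : ℕ) : Qp q) ^ (-n)] := by
    ext a b
    fin_cases a <;> fin_cases b <;> simp [hδ]
  refine ⟨δ, ?_, ?_, fun q hq => ?_⟩
  · rw [hδ, Matrix.det_fin_two_of, mul_zero, sub_zero]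
    exact mul_ne_zero (zpow_ne_zero _ hpQ) (zpow_ne_zero _ hpQ)
  · have hunit : ‖((p : ℕ) : Qp p) ^ (-n) * g 1 1‖ = 1 := by
      rw [norm_mul, Padic.norm_p_zpow, Padic.norm_eq_zpow_neg_valuation hd, neg_neg,
        ← zpow_add₀ hpR]
      simp [n]
    have hdet : ‖(δ.map (Rat.cast : ℚ → Qp p) * g).det‖ = 1 := by
      rw [Matrix.det_mul, hmap, Matrix.det_fin_two_of, mul_zero, sub_zero, norm_mul, norm_mul,
        Padic.norm_p_zpow, Padic.norm_p_zpow, Padic.norm_eq_zpow_neg_valuation hg, neg_neg,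
        neg_neg, ← zpow_add₀ hpR, ← zpow_add₀ hpR]
      simp [m]
    set h := δ.map (Rat.cast : ℚ → Qp p) * g with hh
    have h11 : ‖h 1 1‖ = 1 := by
      rw [hh, hmap, Matrix.mul_apply, Fin.sum_univ_two]
      simpa using hunit
    have h10 : ‖h 1 0‖ ≤ 1 := by
      have : h 1 0 = ((p : ℕ) : Qp p) ^ (-n) * g 1 0 := by
        rw [hh, hmap, Matrix.mul_apply, Fin.sum_univ_two]
        simp
      rw [this, ← hunit, norm_mul, norm_mul]
      gcongr
    have h01 : ‖h 0 1‖ ≤ 1 := by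
      have : h 0 1 = -(-(((p : ℕ) : Qp p) ^ (-m) * g 0 1 / g 1 1) -
          (j : Qp p) * ((p : ℕ) : Qp p) ^ k) * g 1 1 := by
        rw [hh, hmap, Matrix.mul_apply, Fin.sum_univ_two]
        simp only [Matrix.of_apply, Matrix.cons_val_zero, Matrix.cons_val_one]
        field_simp
        ring
      rw [this, norm_mul, norm_neg]
      calc _ ≤ ‖g 1 1‖⁻¹ * ‖g 1 1‖ := by gcongr
        _ = 1 := inv_mul_cancel₀ hdn.ne'
    have h00 : ‖h 0 0‖ ≤ 1 := by
      have e : h 0 0 * h 1 1 = h.det + h 0 1 * h 1 0 := by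
        rw [Matrix.det_fin_two]; ring
      have e' : ‖h 0 0‖ = ‖h.det + h 0 1 * h 1 0‖ := by
        rw [← e, norm_mul, h11, mul_one]
      rw [e']
      refine (Padic.nonarchimedean _ _).trans (max_le hdet.le ?_)
      rw [norm_mul]
      exact mul_le_one₀ h01 (norm_nonneg _) h10
    refine ⟨fun a b => ?_, hdet⟩
    fin_cases a <;> fin_cases b
    exacts [h00, h01, h10, h11.le]
  · have hpq := norm_prime_eq_one_of_ne hq
    rw [hmap]
    refine ⟨fun a b => ?_, by simp [Matrix.det_fin_two_of, hpq]⟩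
    fin_cases a <;> fin_cases b <;> simp [hpq, Padic.norm_int_le_one]

theorem exists_rat_mul_inGL2Zp (p : Nat.Primes) (g : Matrix (Fin 2) (Fin 2) (Qp p))
    (hg : g.det ≠ 0) :
    ∃ δ : Matrix (Fin 2) (Fin 2) ℚ, δ.det ≠ 0 ∧
      InGL2Zp p (δ.map (Rat.cast : ℚ → Qp p) * g) ∧
      ∀ q : Nat.Primes, q ≠ p → InGL2Zp q (δ.map (Rat.cast : ℚ → Qp q)) := by
  rcases le_total ‖g 1 0‖ ‖g 1 1‖ with hle | hle
  · exact exists_rat_mul_inGL2Zp_of_norm_le p g hg hle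
  · set w : Matrix (Fin 2) (Fin 2) (Qp p) := !![0, 1; 1, 0] with hw
    have hwZ : InGL2Zp p w := by
      refine ⟨fun a b => ?_, by simp [hw, Matrix.det_fin_two_of]⟩
      fin_cases a <;> fin_cases b <;> simp [hw]
    have hww : w * w = 1 := by
      rw [hw, Matrix.one_fin_two]
      simp
    obtain ⟨δ, hδ, hp, hq⟩ := exists_rat_mul_inGL2Zp_of_norm_le p (g * w)
      (by rw [Matrix.det_mul]; exact mul_ne_zero hg (by simp [hw, Matrix.det_fin_two_of]))
      (by simpa [hw, Matrix.mul_apply, Fin.sum_univ_two] using hle)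
    refine ⟨δ, hδ, ?_, hq⟩
    have := hp.mul hwZ
    rwa [← Matrix.mul_assoc, Matrix.mul_assoc _ w w, hww, Matrix.mul_one] at this

theorem ratCast_map_mul {K : Type*} [DivisionRing K] [CharZero K]
    (A B : Matrix (Fin 2) (Fin 2) ℚ) :
    (A * B).map (Rat.cast : ℚ → K) = A.map (Rat.cast : ℚ → K) * B.map (Rat.cast : ℚ → K) :=
  Matrix.map_mul (f := Rat.castHom K)

theorem ratCast_map_det {K : Type*} [Field K] [CharZero K] (A : Matrix (Fin 2) (Fin 2) ℚ) :
    (A.map (Rat.cast : ℚ → K)).det = (A.det : K) :=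
  ((Rat.castHom K).map_det A).symm

theorem ratCast_map_det_ne_zero {K : Type*} [Field K] [CharZero K]
    {A : Matrix (Fin 2) (Fin 2) ℚ} (hA : A.det ≠ 0) : (A.map (Rat.cast : ℚ → K)).det ≠ 0 := by
  rw [ratCast_map_det]
  exact Rat.cast_ne_zero.2 hA

/-- Finitely many denominators at the finite places can be cleared by one element of `GL₂(ℚ)`:
the finite adelic group is `GL₂(ℚ) · ∏ GL₂(ℤ_p)`. -/
theorem exists_rat_mul_forall_inGL2Zp (S : Finset Nat.Primes)
    (g : ∀ p : Nat.Primes, Matrix (Fin 2) (Fin 2) (Qp p)) (hg : ∀ p, (g p).det ≠ 0)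
    (hS : ∀ p, p ∉ S → InGL2Zp p (g p)) :
    ∃ δ : Matrix (Fin 2) (Fin 2) ℚ, δ.det ≠ 0 ∧
      ∀ p, InGL2Zp p (δ.map (Rat.cast : ℚ → Qp p) * g p) := by
  induction S using Finset.induction_on generalizing g with
  | empty =>
    exact ⟨1, by simp, fun p => by simpa using hS p (Finset.notMem_empty p)⟩
  | insert p S _ ih =>
    obtain ⟨δ, hδ, hp, hq⟩ := exists_rat_mul_inGL2Zp p (g p) (hg p)
    obtain ⟨η, hη, h⟩ := ih (fun q => δ.map (Rat.cast : ℚ → Qp q) * g q)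
      (fun q => by
        rw [Matrix.det_mul]
        exact mul_ne_zero (ratCast_map_det_ne_zero hδ) (hg q))
      (fun q hqS => by
        by_cases e : q = p
        · subst e
          exact hp
        · exact (hq q e).mul (hS q (by simp [e, hqS])))
    refine ⟨η * δ, by rw [Matrix.det_mul]; exact mul_ne_zero hη hδ, fun q => ?_⟩
    rw [ratCast_map_mul, Matrix.mul_assoc]
    exact h q

/-- The Iwasawa decomposition of a real matrix of positive determinant. -/
theorem exists_iwasawa (M : Matrix (Fin 2) (Fin 2) ℝ) (hM : 0 < M.det) :
    ∃ r x : ℝ, ∃ k : Matrix (Fin 2) (Fin 2) ℝ, r ≠ 0 ∧ SO2 k ∧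
      M = r • (!![1, x; 0, 1] * !![M.det / (M 1 0 ^ 2 + M 1 1 ^ 2), 0; 0, 1] * k) := by
  have hpos : 0 < M 1 0 ^ 2 + M 1 1 ^ 2 := by
    rw [Matrix.det_fin_two] at hM
    by_contra! h
    have h0 : M 1 0 = 0 := by nlinarith [sq_nonneg (M 1 0), sq_nonneg (M 1 1)]
    have h1 : M 1 1 = 0 := by nlinarith [sq_nonneg (M 1 0), sq_nonneg (M 1 1)]
    rw [h0, h1] at hM
    simp at hM
  set s := M 1 0 ^ 2 + M 1 1 ^ 2 with hs
  set r := √s with hr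
  have hr0 : r ≠ 0 := (Real.sqrt_pos.2 hpos).ne'
  have hrr : r ^ 2 = s := Real.sq_sqrt hpos.le
  have hk : (M 1 1 / r) ^ 2 + (M 1 0 / r) ^ 2 = 1 := by
    rw [div_pow, div_pow, hrr, ← add_div, add_comm, ← hs, div_self hpos.ne']
  refine ⟨r, (M 0 0 * M 1 0 + M 0 1 * M 1 1) / s,
    !![M 1 1 / r, -(M 1 0 / r); M 1 0 / r, M 1 1 / r], hr0, ⟨?_, ?_⟩, ?_⟩
  · ext a b
    fin_cases a <;> fin_cases b <;>
      simp [Matrix.mul_apply, Fin.sum_univ_two] <;> linarith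
  · rw [Matrix.det_fin_two_of]
    linarith
  · have hdet := Matrix.det_fin_two M
    ext a b
    fin_cases a <;> fin_cases b <;>
      simp [hdet] <;> field_simp <;> rw [hs] <;> ring

/-- Reduction theory for `SL₂(ℤ)` acting on real matrices of positive determinant. -/
theorem exists_SL2Z_mul_siegel (M : Matrix (Fin 2) (Fin 2) ℝ) (hM : 0 < M.det) :
    ∃ ε : Matrix (Fin 2) (Fin 2) ℤ, ε.det = 1 ∧
      √3 / 2 ≤ (ε.map (Int.cast : ℤ → ℝ) * M).det /
        ((ε.map (Int.cast : ℤ → ℝ) * M) 1 0 ^ 2 + (ε.map (Int.cast : ℤ → ℝ) * M) 1 1 ^ 2) := by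
  let G := Matrix.GeneralLinearGroup.mkOfDetNeZero M hM.ne'
  obtain ⟨γ, hγ⟩ := ModularGroup.exists_smul_mem_fd (G • UpperHalfPlane.I)
  refine ⟨γ, γ.2, ?_⟩
  have h3 := ModularGroup.three_le_four_mul_im_sq_of_mem_fd hγ
  have him : 0 < (γ • G • UpperHalfPlane.I).im := UpperHalfPlane.im_pos _
  have hsqrt : √3 / 2 ≤ (γ • G • UpperHalfPlane.I).im := by
    have : √3 ≤ 2 * (γ • G • UpperHalfPlane.I).im :=
      Real.sqrt_le_iff.2 ⟨by positivity, by nlinarith⟩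
    linarith
  refine hsqrt.trans_eq ?_
  have hcoe : (((γ : GL (Fin 2) ℝ) * G : GL (Fin 2) ℝ) : Matrix (Fin 2) (Fin 2) ℝ) =
      (γ : Matrix (Fin 2) (Fin 2) ℤ).map (Int.cast : ℤ → ℝ) * M := rfl
  have hdet : 0 < ((γ : Matrix (Fin 2) (Fin 2) ℤ).map (Int.cast : ℤ → ℝ) * M).det := by
    have h1 : ((γ : Matrix (Fin 2) (Fin 2) ℤ).map (Int.cast : ℤ → ℝ)).det = 1 := by
      rw [intCast_map_det, γ.2, Int.cast_one]
    rw [Matrix.det_mul, h1, one_mul]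
    exact hM
  rw [ModularGroup.sl_moeb, ← mul_smul, UpperHalfPlane.im_smul_eq_div_normSq,
    UpperHalfPlane.denom, Matrix.GeneralLinearGroup.val_det_apply, hcoe, abs_of_pos hdet,
    Complex.normSq_apply]
  simp
  ring

/-- Every real invertible matrix lies in `GL₂(ℤ)` times a Siegel domain. -/
theorem exists_int_mul_eq_siegel (M : Matrix (Fin 2) (Fin 2) ℝ) (hM : M.det ≠ 0) :
    ∃ ε : Matrix (Fin 2) (Fin 2) ℤ, (ε.det = 1 ∨ ε.det = -1) ∧
      ∃ r x y : ℝ, ∃ k : Matrix (Fin 2) (Fin 2) ℝ, r ≠ 0 ∧ √3 / 2 ≤ y ∧ SO2 k ∧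
        ε.map (Int.cast : ℤ → ℝ) * M = r • (!![1, x; 0, 1] * !![y, 0; 0, 1] * k) := by
  obtain ⟨σ, hσ, hpos⟩ : ∃ σ : Matrix (Fin 2) (Fin 2) ℤ, (σ.det = 1 ∨ σ.det = -1) ∧
      0 < (σ.map (Int.cast : ℤ → ℝ) * M).det := by
    rcases hM.lt_or_gt with h | h
    · refine ⟨!![-1, 0; 0, 1], by simp [Matrix.det_fin_two_of], ?_⟩
      rw [Matrix.det_mul]
      simpa [Matrix.det_fin_two] using h
    · exact ⟨1, by simp, by simpa using h⟩
  obtain ⟨ε, hε, hy⟩ := exists_SL2Z_mul_siegel _ hpos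
  have hε' : (ε.map (Int.cast : ℤ → ℝ)).det = 1 := by
    rw [intCast_map_det, hε, Int.cast_one]
  obtain ⟨r, x, k, hr, hk, e⟩ := exists_iwasawa (ε.map (Int.cast : ℤ → ℝ) *
    (σ.map (Int.cast : ℤ → ℝ) * M)) (by rwa [Matrix.det_mul, hε', one_mul])
  refine ⟨ε * σ, by simpa [Matrix.det_mul, hε] using hσ, r, x, _, k, hr, hy, hk, ?_⟩
  rw [← e, ← Matrix.mul_assoc]
  congr 1
  exact Matrix.map_mul (f := Int.castRingHom ℝ)

/-- Let `N ≥ 1` and let `Γ = ∏_p Γ_p` be a subgroup of `GL₂(𝔸_ℚ)` with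
`Γ_∞ = SO₂(ℝ)`, each `Γ_p` an open subgroup of `GL₂(ℤ_p)` whose image under the
determinant is `ℤ_p^×`, and `Γ_p = GL₂(ℤ_p)` for `p ∤ N`. Then `𝒟_N` contains
representatives of every double coset of `Z(𝔸_ℚ) GL₂(ℚ) \ GL₂(𝔸_ℚ) / Γ`: every
`g ∈ GL₂(𝔸_ℚ)` can be written as `g = z γ d k` with `z ∈ Z(𝔸_ℚ)`, `γ ∈ GL₂(ℚ)`,
`d ∈ 𝒟_N` and `k ∈ Γ`. -/
theorem generating_domain (N : ℕ) (hN : 0 < N)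
    (Γ : ∀ p : Nat.Primes, Set (Matrix (Fin 2) (Fin 2) (Qp p)))
    (hΓ_sub : ∀ p, ∀ k ∈ Γ p, InGL2Zp p k)
    (hΓ_one : ∀ p, (1 : Matrix (Fin 2) (Fin 2) (Qp p)) ∈ Γ p)
    (hΓ_mul : ∀ p, ∀ k₁ ∈ Γ p, ∀ k₂ ∈ Γ p, k₁ * k₂ ∈ Γ p)
    (hΓ_inv : ∀ p, ∀ k ∈ Γ p, ∃ k' ∈ Γ p, k * k' = 1)
    (hΓ_open : ∀ p, IsOpen (Γ p))
    (hΓ_det : ∀ p, ∀ u : Qp p, ‖u‖ = 1 → ∃ k ∈ Γ p, k.det = u)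
    (hΓ_full : ∀ p : Nat.Primes, ¬ (p : ℕ) ∣ N → Γ p = {k | InGL2Zp p k})
    (g : AdelicGL2) :
    ∃ (z : AdelicGL2) (γ : Matrix (Fin 2) (Fin 2) ℚ) (d : AdelicGL2)
      (kinf : Matrix (Fin 2) (Fin 2) ℝ)
      (kfin : ∀ p : Nat.Primes, Matrix (Fin 2) (Fin 2) (Qp p)),
      z.IsCentral ∧ IsUnit γ.det ∧ InDN N d ∧ SO2 kinf ∧ (∀ p, kfin p ∈ Γ p) ∧
      g.infty = z.infty * γ.map (Rat.cast : ℚ → ℝ) * d.infty * kinf ∧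
      ∀ p : Nat.Primes,
        g.fin p = z.fin p * γ.map (Rat.cast : ℚ → Qp p) * d.fin p * kfin p := by
  obtain ⟨δ, hδ, hδZ⟩ := exists_rat_mul_forall_inGL2Zp g.finite_not_integral.toFinset g.fin
    (fun p => (g.isUnit_fin p).ne_zero) (fun p hp => by simpa using hp)
  obtain ⟨ε, hε, r, x, y, kinf, hr, hy, hk, e⟩ := exists_int_mul_eq_siegel
    (δ.map (Rat.cast : ℚ → ℝ) * g.infty) (by
      rw [Matrix.det_mul]
      exact mul_ne_zero (ratCast_map_det_ne_zero hδ) g.isUnit_infty.ne_zero)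
  have hy0 : 0 < y := lt_of_lt_of_le (by positivity) hy
  set ε' : Matrix (Fin 2) (Fin 2) ℚ := ε.map (Int.cast : ℤ → ℚ) with hε'
  have hε'0 : ε'.det ≠ 0 := by
    rw [hε', intCast_map_det]
    rcases hε with h | h <;> simp [h]
  have hεmap (K : Type) [DivisionRing K] [CharZero K] :
      ε'.map (Rat.cast : ℚ → K) = ε.map (Int.cast : ℤ → K) := by
    ext a b
    simp [hε']
  set η := ε' * δ with hη
  have hη0 : IsUnit η.det := by
    rw [hη, Matrix.det_mul]
    exact (mul_ne_zero hε'0 hδ).isUnit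
  have hinv (K : Type) [DivisionRing K] [CharZero K] (A : Matrix (Fin 2) (Fin 2) K) :
      η⁻¹.map (Rat.cast : ℚ → K) * (η.map (Rat.cast : ℚ → K) * A) = A := by
    rw [← Matrix.mul_assoc, ← ratCast_map_mul, Matrix.nonsing_inv_mul _ hη0,
      Matrix.map_one _ Rat.cast_zero Rat.cast_one, Matrix.one_mul]
  have hηZ (p : Nat.Primes) : InGL2Zp p (η.map (Rat.cast : ℚ → Qp p) * g.fin p) := by
    rw [hη, ratCast_map_mul, hεmap, Matrix.mul_assoc]
    exact (inGL2Zp_intCast p hε).mul (hδZ p)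
  have hηinf : η.map (Rat.cast : ℚ → ℝ) * g.infty =
      r • (!![1, x; 0, 1] * !![y, 0; 0, 1] * kinf) := by
    rw [hη, ratCast_map_mul, hεmap, Matrix.mul_assoc, e]
  classical
  let dfin (p : Nat.Primes) : Matrix (Fin 2) (Fin 2) (Qp p) :=
    if (p : ℕ) ∣ N then η.map (Rat.cast : ℚ → Qp p) * g.fin p else 1
  have hdZ (p : Nat.Primes) : InGL2Zp p (dfin p) := by
    dsimp only [dfin]
    split_ifs
    exacts [hηZ p, inGL2Zp_one p]
  let z : AdelicGL2 :=
    { infty := r • 1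
      fin := fun _ => 1
      isUnit_infty := by simp [hr]
      isUnit_fin := by simp
      finite_not_integral := by simp [inGL2Zp_one] }
  let d : AdelicGL2 :=
    { infty := !![1, x; 0, 1] * !![y, 0; 0, 1]
      fin := dfin
      isUnit_infty := by simp [Matrix.det_fin_two_of, hy0.ne']
      isUnit_fin := fun p => by
        rw [isUnit_iff_ne_zero, ← norm_ne_zero_iff, (hdZ p).2]
        exact one_ne_zero
      finite_not_integral := by simp [hdZ] }
  refine ⟨z, η⁻¹, d, kinf, fun p => if (p : ℕ) ∣ N then 1 else
    η.map (Rat.cast : ℚ → Qp p) * g.fin p, ⟨⟨r, rfl⟩, fun p => ⟨1, by simp [z]⟩⟩,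
    (Matrix.isUnit_nonsing_inv_det_iff).2 hη0, ⟨⟨x, y, hy, rfl⟩, fun p hp => if_neg hp, hdZ⟩,
    hk, fun p => ?_, ?_, fun p => ?_⟩
  · dsimp only
    split_ifs with hp
    · exact hΓ_one p
    · rw [hΓ_full p hp]
      exact hηZ p
  · rw [← hinv ℝ g.infty, hηinf]
    simp only [z, d, Matrix.mul_smul, Matrix.smul_mul, Matrix.one_mul, Matrix.mul_assoc]
  · dsimp only [z, d, dfin]
    split_ifs <;> simp [hinv]

end
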